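/- arXiv:2310.11654 — 3 statements merged into one kernel-verified Lean document; each statement's English description precedes it below -/
import Mathlib

section
/- Let n ≥ 1, let λ̂ > 0, and let v̂_1, …, v̂_n be real numbers with (1/n)∑_{i=1}^n exp(v̂_i) = 1 + ε for some ε ∈ ℝ (necessarily ε > -1). Define the adjusted predictors v̂*_i = v̂_i - log(1+ε). Then ∑_{i=1}^n (v̂*_i - exp(v̂*_i))/λ̂ ≥ ∑_{i=1}^n (v̂_i - exp(v̂_i))/λ̂, with equality if and only if ε = 0. (Since the remaining terms of the h-likelihood are unchanged under the simultaneous adjustment β̂*_0 = β̂_0 + log(1+ε), this shows the adjustment (û_i ← û_i/((1/n)∑û_i), β̂_0 ← β̂_0 + log((1/n)∑û_i)) never decreases the h-likelihood.) -/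
open Real Finset

/-- Shifting each log-scale predictor by the log of the mean of `exp ∘ v` changes the
h-likelihood contribution by `n * (ε - log (1 + ε)) / lam`. -/
theorem sum_sub_log_sub_exp_div_eq {n : ℕ} (hn : n ≠ 0) (lam : ℝ) (v : Fin n → ℝ) {ε : ℝ}
    (hpos : 0 < 1 + ε) (hε : (1 / (n : ℝ)) * ∑ i, Real.exp (v i) = 1 + ε) :
    ∑ i, ((v i - Real.log (1 + ε)) - Real.exp (v i - Real.log (1 + ε))) / lam
      = ∑ i, (v i - Real.exp (v i)) / lam + n * (ε - Real.log (1 + ε)) / lam := by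
  have hn' : (n : ℝ) ≠ 0 := Nat.cast_ne_zero.mpr hn
  have hsum : ∑ i, Real.exp (v i) = n * (1 + ε) := by
    rw [← hε]
    field_simp
  simp only [Real.exp_sub, Real.exp_log hpos, ← Finset.sum_div, Finset.sum_sub_distrib, hsum,
    Finset.sum_const, Finset.card_univ, Fintype.card_fin, nsmul_eq_mul,
    mul_div_cancel_right₀ _ hpos.ne']
  ring

/-- Random effect adjustment never decreases the h-likelihood contribution of
the random effects, with equality iff ε = 0. -/
theorem random_effect_adjustment_improves
    (n : ℕ) (hn : 1 ≤ n) (lam : ℝ) (hlam : 0 < lam)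
    (v : Fin n → ℝ) (ε : ℝ)
    (hε : (1 / (n : ℝ)) * ∑ i, Real.exp (v i) = 1 + ε) :
    (∑ i, ((v i - Real.log (1 + ε)) - Real.exp (v i - Real.log (1 + ε))) / lam
      ≥ ∑ i, (v i - Real.exp (v i)) / lam)
    ∧ ((∑ i, ((v i - Real.log (1 + ε)) - Real.exp (v i - Real.log (1 + ε))) / lam
        = ∑ i, (v i - Real.exp (v i)) / lam) ↔ ε = 0) := by
  have hn0 : n ≠ 0 := by lia
  have hnpos : (0 : ℝ) < n := by exact_mod_cast hn
  have hpos : 0 < 1 + ε := by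
    rw [← hε]
    have : NeZero n := ⟨hn0⟩
    have : 0 < ∑ i, Real.exp (v i) :=
      Finset.sum_pos (fun i _ => Real.exp_pos _) Finset.univ_nonempty
    positivity
  rw [sum_sub_log_sub_exp_div_eq hn0 lam v hpos hε]
  have hlog : Real.log (1 + ε) ≤ ε := by linarith [Real.log_le_sub_one_of_pos hpos]
  refine ⟨le_add_of_nonneg_right (by have := sub_nonneg.mpr hlog; positivity), ?_, ?_⟩
  · intro h
    by_contra hne
    have hlt : Real.log (1 + ε) < ε := by
      linarith [Real.log_lt_sub_one_of_pos hpos (by simpa using hne)]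
    have : 0 < n * (ε - Real.log (1 + ε)) / lam :=
      div_pos (mul_pos hnpos (sub_pos.mpr hlt)) hlam
    linarith
  · rintro rfl
    simp
end

section
/- Let q ≥ 1, y_1, …, y_q ∈ ℕ, μ_1, …, μ_q > 0, and λ > 0, with y_+ = ∑_j y_j and μ_+ = ∑_j μ_j. Let ṽ = log((y_+ + 1/λ)/(μ_+ + 1/λ)) and c(λ; y_+) = (y_+ + λ^{-1}) + log Γ(y_+ + λ^{-1}) - (y_+ + λ^{-1}) log(y_+ + λ^{-1}). Then the h-likelihood evaluated at the mode equals the marginal log-likelihood: ∑_{j=1}^q [y_j·(log μ_j + ṽ) - μ_j·e^{ṽ} - log(y_j!)] + [(ṽ - e^{ṽ})/λ - (1/λ)·log λ - log Γ(1/λ)] + c(λ; y_+) = log( [∏_{j=1}^q μ_j^{y_j}/y_j!] · λ^{-1/λ} · Γ(y_+ + 1/λ) / (Γ(1/λ) · (μ_+ + 1/λ)^{y_+ + 1/λ}) ). -/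
open Real Finset

/-- The h-likelihood of a single cluster evaluated at the mode `ṽ` equals the
marginal log-likelihood. -/
theorem h_likelihood_at_mode_eq_marginal_loglik
    (q : ℕ) (hq : 1 ≤ q) (y : Fin q → ℕ) (μ : Fin q → ℝ)
    (hμ : ∀ j, 0 < μ j) (lam : ℝ) (hlam : 0 < lam) :
    (∑ j, ((y j : ℝ)
          * (Real.log (μ j)
              + Real.log (((∑ j, (y j : ℝ)) + 1 / lam) / ((∑ j, μ j) + 1 / lam)))
        - μ j * Real.exp (Real.log (((∑ j, (y j : ℝ)) + 1 / lam) / ((∑ j, μ j) + 1 / lam)))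
        - Real.log (Nat.factorial (y j) : ℝ)))
      + ((Real.log (((∑ j, (y j : ℝ)) + 1 / lam) / ((∑ j, μ j) + 1 / lam))
            - Real.exp (Real.log (((∑ j, (y j : ℝ)) + 1 / lam) / ((∑ j, μ j) + 1 / lam)))) / lam
          - (1 / lam) * Real.log lam - Real.log (Real.Gamma (1 / lam)))
      + (((∑ j, (y j : ℝ)) + lam⁻¹)
          + Real.log (Real.Gamma ((∑ j, (y j : ℝ)) + lam⁻¹))
          - ((∑ j, (y j : ℝ)) + lam⁻¹) * Real.log ((∑ j, (y j : ℝ)) + lam⁻¹))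
      = Real.log ((∏ j, μ j ^ (y j) / (Nat.factorial (y j) : ℝ))
          * lam ^ (-(1 / lam))
          * Real.Gamma ((∑ j, (y j : ℝ)) + 1 / lam)
          / (Real.Gamma (1 / lam)
              * ((∑ j, μ j) + 1 / lam) ^ ((∑ j, (y j : ℝ)) + 1 / lam))) := by
  have hY : 0 ≤ ∑ j, (y j : ℝ) := Finset.sum_nonneg fun j _ => Nat.cast_nonneg _
  have hM : 0 ≤ ∑ j, μ j := Finset.sum_nonneg fun j _ => (hμ j).le
  have hfac : ∀ j, (Nat.factorial (y j) : ℝ) ≠ 0 := fun j =>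
    Nat.cast_ne_zero.mpr (Nat.factorial_ne_zero _)
  have hterm : ∀ j, μ j ^ y j / (Nat.factorial (y j) : ℝ) ≠ 0 := fun j =>
    div_ne_zero (pow_ne_zero _ (hμ j).ne') (hfac j)
  have hprod : Real.log (∏ j, μ j ^ y j / (Nat.factorial (y j) : ℝ))
      = ∑ j, (y j : ℝ) * Real.log (μ j) - ∑ j, Real.log (Nat.factorial (y j) : ℝ) := by
    rw [Real.log_prod fun j _ => hterm j, ← Finset.sum_sub_distrib]
    exact Finset.sum_congr rfl fun j _ => by
      rw [Real.log_div (pow_ne_zero _ (hμ j).ne') (hfac j), Real.log_pow]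
  have hP : ∏ j, μ j ^ y j / (Nat.factorial (y j) : ℝ) ≠ 0 :=
    Finset.prod_ne_zero_iff.mpr fun j _ => hterm j
  simp only [← one_div, mul_add, Finset.sum_add_distrib, Finset.sum_sub_distrib,
    ← Finset.sum_mul]
  generalize (∑ j, (y j : ℝ)) = Y at *
  generalize (∑ j, μ j) = M at *
  have hr : 0 < 1 / lam := one_div_pos.mpr hlam
  have hA : 0 < Y + 1 / lam := by positivity
  have hB : 0 < M + 1 / lam := by positivity
  have hΓA := (Real.Gamma_pos_of_pos hA).ne'
  have hΓr := (Real.Gamma_pos_of_pos hr).ne'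
  have hlr : lam ^ (-(1 / lam)) ≠ 0 := (Real.rpow_pos_of_pos hlam _).ne'
  have hBA : (M + 1 / lam) ^ (Y + 1 / lam) ≠ 0 := (Real.rpow_pos_of_pos hB _).ne'
  rw [Real.log_div (mul_ne_zero (mul_ne_zero hP hlr) hΓA) (mul_ne_zero hΓr hBA),
    Real.log_mul (mul_ne_zero hP hlr) hΓA, Real.log_mul hP hlr, Real.log_mul hΓr hBA,
    Real.log_rpow hlam, Real.log_rpow hB, hprod, Real.exp_log (div_pos hA hB),
    Real.log_div hA.ne' hB.ne']
  have hcancel : (M + 1 / lam) * ((Y + 1 / lam) / (M + 1 / lam)) = Y + 1 / lam :=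
    mul_div_cancel₀ _ hB.ne'
  linear_combination -hcancel
end

section
/- Let λ > 0, and let (A_n) and (B_n) be sequences of nonnegative real numbers such that A_n + B_n/λ → λ as n → ∞. For each n, let λ̂_n = (A_n + √(A_n² + 4B_n))/2 be the largest root of x² - A_n x - B_n = 0. Then λ̂_n → λ as n → ∞. -/
open Real Filter

/-- The largest root of `x² - a x - b` is at least as close to `lam` as `a + b / lam` is. -/
theorem abs_largest_root_sub_le {lam a b : ℝ} (hlam : 0 < lam) (hb : 0 ≤ b) :
    |(a + √(a ^ 2 + 4 * b)) / 2 - lam| ≤ |a + b / lam - lam| := by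
  set x := (a + √(a ^ 2 + 4 * b)) / 2 with hx
  have hsq : √(a ^ 2 + 4 * b) ^ 2 = a ^ 2 + 4 * b := Real.sq_sqrt (by positivity)
  have hroot : x ^ 2 = a * x + b := by rw [hx]; linarith
  have hax : a ≤ x := by
    have : a ≤ √(a ^ 2 + 4 * b) := Real.le_sqrt_of_sq_le (by linarith)
    linarith
  have hfactor : (x - lam) * (x + lam - a) = lam * (a + b / lam - lam) := by
    field_simp
    linarith
  have habs : |x - lam| * (x + lam - a) = lam * |a + b / lam - lam| := by
    rw [← abs_of_pos (show 0 < x + lam - a by linarith), ← abs_mul, hfactor, abs_mul,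
      abs_of_pos hlam]
  refine le_of_mul_le_mul_left ?_ hlam
  nlinarith [mul_nonneg (abs_nonneg (x - lam)) (sub_nonneg.2 hax)]

/-- Consistency of the method-of-moments estimator: if `A_n + B_n/λ → λ`, then
the largest root `λ̂_n = (A_n + √(A_n² + 4B_n))/2` of `x² - A_n x - B_n = 0`
converges to `λ`. -/
theorem mme_consistency
    (lam : ℝ) (hlam : 0 < lam)
    (A B : ℕ → ℝ) (hA : ∀ n, 0 ≤ A n) (hB : ∀ n, 0 ≤ B n)
    (hconv : Tendsto (fun n => A n + B n / lam) atTop (nhds lam)) :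
    Tendsto (fun n => (A n + Real.sqrt ((A n) ^ 2 + 4 * B n)) / 2)
      atTop (nhds lam) := by
  rw [tendsto_iff_dist_tendsto_zero] at hconv ⊢
  exact squeeze_zero (fun _ => dist_nonneg)
    (fun n => abs_largest_root_sub_le hlam (hB n)) hconv
end
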